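/- Let c₁,…,c_{p+1} ⊂ gl(n,ℂ) be conjugacy classes with generic eigenvalues satisfying d(c₁) + … + d(c_{p+1}) = 2n² − 2. If (A₁,…,A_{p+1}) and (A′₁,…,A′_{p+1}) are two irreducible (p+1)-tuples with A_j, A′_j ∈ c_j and A₁ + … + A_{p+1} = 0 = A′₁ + … + A′_{p+1}, then there exists S ∈ GL(n,ℂ) with A′_j = S A_j S^{−1} for every j. -/

import Mathlib

open Matrix BigOperators

/-- `B` lies in the conjugacy class of `A` (conjugation by an invertible matrix). -/
def MatConj {n : ℕ} (A B : Matrix (Fin n) (Fin n) ℂ) : Prop :=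
  ∃ S : (Matrix (Fin n) (Fin n) ℂ)ˣ, B = S.val * A * (S⁻¹).val

/-- A tuple of `n × n` matrices is irreducible if no subspace of `ℂⁿ` other than `⊥` and `⊤`
is invariant under all of them. -/
def IrreducibleTuple {q n : ℕ} (M : Fin q → Matrix (Fin n) (Fin n) ℂ) : Prop :=
  ∀ V : Submodule ℂ (Fin n → ℂ),
    (∀ j, V.map (Matrix.mulVecLin (M j)) ≤ V) → V = ⊥ ∨ V = ⊤

/-- The dimension of the conjugacy class of `A` : `n² - dim (centralizer of A)`. -/
noncomputable def classDim {n : ℕ} (A : Matrix (Fin n) (Fin n) ℂ) : ℕ :=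
  n ^ 2 - Module.finrank ℂ
    (LinearMap.ker (LinearMap.mulLeft ℂ A - LinearMap.mulRight ℂ A))

/-- Genericity of the eigenvalues (= roots of the characteristic polynomials, with
multiplicity): no sums of sub-multisets of equal cardinality `κ`, `1 ≤ κ ≤ n-1`, equal `0`. -/
def GenericAddRoots {q n : ℕ} (M : Fin q → Matrix (Fin n) (Fin n) ℂ) : Prop :=
  ∀ κ : ℕ, 1 ≤ κ → κ ≤ n - 1 →
    ∀ Φ : Fin q → Multiset ℂ,
      (∀ j, Φ j ≤ (M j).charpoly.roots ∧ Multiset.card (Φ j) = κ) →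
      (∑ j, (Φ j).sum) ≠ 0

/-- A nonzero intertwiner between irreducible tuples is invertible. -/
theorem isUnit_of_intertwine {q n : ℕ} (A B : Fin q → Matrix (Fin n) (Fin n) ℂ)
    (hA : IrreducibleTuple A) (X : Matrix (Fin n) (Fin n) ℂ) (hX : X ≠ 0)
    (h : ∀ j, B j * X = X * A j) : IsUnit X := by
  have hk := hA (LinearMap.ker X.mulVecLin) (by
    intro j
    rintro _ ⟨v, hv, rfl⟩
    simp only [SetLike.mem_coe, LinearMap.mem_ker, Matrix.mulVecLin_apply] at hv ⊢
    rw [Matrix.mulVec_mulVec, ← h j, ← Matrix.mulVec_mulVec, hv, Matrix.mulVec_zero])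
  rcases hk with hk | hk
  · rw [LinearMap.ker_eq_bot] at hk
    exact Matrix.mulVec_injective_iff_isUnit.mp hk
  · exfalso
    apply hX
    rw [LinearMap.ker_eq_top] at hk
    ext i j
    have := congrFun (LinearMap.congr_fun hk (Pi.single j 1)) i
    simpa using this

/-- Every linear functional on matrices is a trace pairing. -/
theorem dual_eq_trace {n : ℕ} (f : Matrix (Fin n) (Fin n) ℂ →ₗ[ℂ] ℂ) :
    ∃ Z : Matrix (Fin n) (Fin n) ℂ, ∀ X, f X = (Z * X).trace := by
  refine ⟨Matrix.of fun i j => f (Matrix.single j i 1), fun X => ?_⟩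
  conv_lhs => rw [Matrix.matrix_eq_sum_single X]
  simp only [map_sum, Matrix.trace, Matrix.diag, Matrix.mul_apply, Matrix.of_apply]
  rw [Finset.sum_comm]
  refine Finset.sum_congr rfl fun i _ => Finset.sum_congr rfl fun j _ => ?_
  have : Matrix.single j i (X j i) = X j i • Matrix.single j i (1 : ℂ) := by
    simp [Matrix.smul_single]
  rw [this, map_smul, smul_eq_mul, mul_comm]

theorem finrank_range_intertwine {n : ℕ} (A B : Matrix (Fin n) (Fin n) ℂ) (h : MatConj A B) :
    Module.finrank ℂ (LinearMap.range (LinearMap.mulLeft ℂ B - LinearMap.mulRight ℂ A))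
      = classDim A := by
  obtain ⟨S, rfl⟩ := h
  have hn : Module.finrank ℂ (Matrix (Fin n) (Fin n) ℂ) = n ^ 2 := by
    simp [Module.finrank_matrix, sq]
  have h1 := LinearMap.finrank_range_add_finrank_ker (LinearMap.mulLeft ℂ A - LinearMap.mulRight ℂ A)
  have h2 : Module.finrank ℂ (LinearMap.range
      (LinearMap.mulLeft ℂ (S.val * A * (S⁻¹).val) - LinearMap.mulRight ℂ A))
      = Module.finrank ℂ (LinearMap.range (LinearMap.mulLeft ℂ A - LinearMap.mulRight ℂ A)) := by
    let e : Matrix (Fin n) (Fin n) ℂ ≃ₗ[ℂ] Matrix (Fin n) (Fin n) ℂ :=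
      LinearEquiv.ofLinearMap (LinearMap.mulLeft ℂ S.val) (LinearMap.mulLeft ℂ (S⁻¹).val)
        (by ext1 X; simp) (by ext1 X; simp)
    have he : LinearMap.mulLeft ℂ (S.val * A * (S⁻¹).val) - LinearMap.mulRight ℂ A
        = (e.toLinearMap ∘ₗ (LinearMap.mulLeft ℂ A - LinearMap.mulRight ℂ A)) ∘ₗ
            e.symm.toLinearMap := by
      apply LinearMap.ext
      intro X
      simp [e, mul_sub, mul_assoc]
    rw [he, LinearEquiv.range_comp, LinearMap.range_comp]
    exact LinearEquiv.finrank_map_eq e _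
  unfold classDim
  rw [h2]
  omega

/-- rigidity: uniqueness up to conjugacy, additive version. For conjugacy
classes with generic eigenvalues and `d₁ + ⋯ + d_{p+1} = 2n² - 2`, two irreducible solutions
of `A 1 + ⋯ + A (p+1) = 0` in the same classes are simultaneously conjugate. -/
theorem stmt5 (n p : ℕ)
    (A A' : Fin (p + 1) → Matrix (Fin n) (Fin n) ℂ)
    (hcls : ∀ j, MatConj (A j) (A' j))
    (hgen : GenericAddRoots A)
    (hd : (∑ j, classDim (A j)) = 2 * n ^ 2 - 2)
    (hirr : IrreducibleTuple A) (hirr' : IrreducibleTuple A')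
    (hsum : (∑ j, A j) = 0) (hsum' : (∑ j, A' j) = 0) :
    ∃ S : (Matrix (Fin n) (Fin n) ℂ)ˣ,
      ∀ j, A' j = S.val * A j * (S⁻¹).val := by
  rcases Nat.eq_zero_or_pos n with rfl | hpos
  · exact ⟨1, fun j => Subsingleton.elim _ _⟩
  have hn : Module.finrank ℂ (Matrix (Fin n) (Fin n) ℂ) = n ^ 2 := by
    simp [Module.finrank_matrix, sq]
  let L : Fin (p + 1) → Matrix (Fin n) (Fin n) ℂ →ₗ[ℂ] Matrix (Fin n) (Fin n) ℂ :=
    fun j => LinearMap.mulLeft ℂ (A' j) - LinearMap.mulRight ℂ (A j)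
  have hL : ∀ j X, L j X = A' j * X - X * A j := fun j X => by simp [L]
  let φ : Matrix (Fin n) (Fin n) ℂ →ₗ[ℂ] (∀ j, LinearMap.range (L j)) :=
    LinearMap.pi fun j => (L j).rangeRestrict
  let T : (∀ j, LinearMap.range (L j)) →ₗ[ℂ] Matrix (Fin n) (Fin n) ℂ :=
    ∑ j, (LinearMap.range (L j)).subtype ∘ₗ LinearMap.proj j
  by_cases hφ : LinearMap.ker φ = ⊥
  · have hle : LinearMap.range φ ≤ LinearMap.ker T := by
      rintro _ ⟨X, rfl⟩
      rw [LinearMap.mem_ker]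
      have : T (φ X) = ∑ j, L j X := by simp [T, φ]
      rw [this]
      simp only [hL, Finset.sum_sub_distrib, ← Finset.sum_mul, ← Finset.mul_sum, hsum, hsum']
      simp
    have h1 := Submodule.finrank_mono hle
    rw [LinearMap.finrank_range_of_inj (LinearMap.ker_eq_bot.mp hφ), hn] at h1
    have h2 := LinearMap.finrank_range_add_finrank_ker T
    rw [Module.finrank_pi_fintype,
      Finset.sum_congr rfl (fun j _ => finrank_range_intertwine (A j) (A' j) (hcls j)), hd] at h2
    have hpos2 : 0 < n ^ 2 := by positivity
    have hlt : LinearMap.range T < ⊤ := by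
      rw [lt_top_iff_ne_top]
      intro ht
      rw [ht, finrank_top, hn] at h2
      omega
    obtain ⟨f, hf0, hf⟩ := Submodule.exists_le_ker_of_lt_top _ hlt
    obtain ⟨Z, hZ⟩ := dual_eq_trace f
    have hfL : ∀ j X, f (L j X) = 0 := by
      intro j X
      apply LinearMap.mem_ker.mp
      apply hf
      refine ⟨Pi.single j ⟨L j X, X, rfl⟩, ?_⟩
      simp only [T, LinearMap.sum_apply, LinearMap.comp_apply, LinearMap.proj_apply,
        Submodule.subtype_apply]
      rw [Finset.sum_eq_single j]
      · simp
      · intro b _ hb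
        rw [Pi.single_eq_of_ne hb]
        rfl
      · simp
    have hZ0 : Z ≠ 0 := by
      rintro rfl
      apply hf0
      ext1 X
      simp [hZ]
    have hint : ∀ j, A j * Z = Z * A' j := by
      intro j
      apply Matrix.ext_iff_trace_mul_right.mpr
      intro X
      have := hfL j X
      rw [hZ, hL, mul_sub, Matrix.trace_sub, sub_eq_zero] at this
      rw [mul_assoc, mul_assoc, this, ← mul_assoc Z, Matrix.trace_mul_comm (Z * X)]
    obtain ⟨U, rfl⟩ := isUnit_of_intertwine A' A hirr' Z hZ0 hint
    refine ⟨U⁻¹, fun j => ?_⟩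
    rw [inv_inv, mul_assoc, hint j, ← mul_assoc]
    simp
  · obtain ⟨X, hX, hX0⟩ := Submodule.exists_mem_ne_zero_of_ne_bot hφ
    have hint : ∀ j, A' j * X = X * A j := by
      intro j
      have h := congrArg Subtype.val (congrFun (LinearMap.mem_ker.mp hX) j)
      have h' : L j X = 0 := h
      rwa [hL, sub_eq_zero] at h'
    obtain ⟨U, rfl⟩ := isUnit_of_intertwine A A' hirr X hX0 hint
    refine ⟨U, fun j => ?_⟩
    rw [← hint j, mul_assoc]
    simp
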